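/- Let K be a convex body in ℝⁿ with the origin in its interior. Then for every 1 ≤ i ≤ n, λᵢ(K*) ≤ λᵢ((cs K)*). -/

import Mathlib

open MeasureTheory
open scoped RealInnerProductSpace Pointwise

noncomputable section

/-- Euclidean `n`-space. -/
abbrev E (n : ℕ) := EuclideanSpace ℝ (Fin n)

/-- A convex body: a compact convex set with nonempty interior. -/
def IsConvexBody {n : ℕ} (K : Set (E n)) : Prop :=
  Convex ℝ K ∧ IsCompact K ∧ (interior K).Nonempty

/-- Central symmetral `cs K = (1/2)(K - K)`. -/
def csBody {n : ℕ} (K : Set (E n)) : Set (E n) := (2⁻¹ : ℝ) • (K - K)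

/-- Polar body `L* = {y : ⟨x, y⟩ ≤ 1 for all x ∈ L}`. -/
def polarBody {n : ℕ} (L : Set (E n)) : Set (E n) :=
  {y | ∀ x ∈ L, ⟪x, y⟫ ≤ 1}

/-- A point of the integer lattice `ℤⁿ ⊆ ℝⁿ`. -/
def isLatticePoint {n : ℕ} (z : E n) : Prop := ∀ j, ∃ m : ℤ, z j = (m : ℝ)

/-- The `i`-th successive minimum of `L` with respect to the lattice `ℤⁿ`:
the least `λ > 0` such that `λ • L` contains `i` linearly independent lattice points. -/
def succMin {n : ℕ} (L : Set (E n)) (i : ℕ) : ℝ :=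
  sInf {lam : ℝ | 0 < lam ∧ ∃ v : Fin i → E n,
    LinearIndependent ℝ v ∧ ∀ j, isLatticePoint (v j) ∧ v j ∈ lam • L}

theorem mem_smul_polarBody {n : ℕ} {L : Set (E n)} {lam : ℝ} (hlam : 0 < lam) {y : E n} :
    y ∈ lam • polarBody L ↔ ∀ x ∈ L, ⟪x, y⟫ ≤ lam := by
  rw [Set.mem_smul_set_iff_inv_smul_mem₀ hlam.ne']
  simp only [polarBody, Set.mem_ofPred_eq, real_inner_smul_right, inv_mul_le_one₀ hlam]

/-- Up to sign, a point of a dilate of `(cs K)*` lies in the same dilate of `K*`. -/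
theorem exists_units_smul_mem_smul_polarBody {n : ℕ} {K : Set (E n)} {lam : ℝ} (hlam : 0 < lam)
    {y : E n} (hy : y ∈ lam • polarBody (csBody K)) :
    ∃ u : ℤˣ, u • y ∈ lam • polarBody K := by
  rw [mem_smul_polarBody hlam] at hy
  by_contra! h
  have h₁ := h 1
  have h₂ := h (-1)
  simp only [mem_smul_polarBody hlam, one_smul, Units.neg_smul, inner_neg_right, not_forall,
    not_le] at h₁ h₂
  obtain ⟨x₁, hx₁, h₁⟩ := h₁
  obtain ⟨x₂, hx₂, h₂⟩ := h₂
  have h₃ := hy _ (Set.smul_mem_smul_set (Set.sub_mem_sub hx₁ hx₂))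
  rw [real_inner_smul_left, inner_sub_left] at h₃
  linarith

theorem isLatticePoint.units_smul {n : ℕ} {z : E n} (hz : isLatticePoint z) (u : ℤˣ) :
    isLatticePoint (u • z) := by
  intro j
  obtain ⟨m, hm⟩ := hz j
  rcases Int.units_eq_one_or u with rfl | rfl
  · exact ⟨m, by simpa using hm⟩
  · exact ⟨-m, by simp [hm]⟩

theorem linearIndependent_int_units_smul {ι V : Type*} [AddCommGroup V] [Module ℝ V] {v : ι → V}
    (hv : LinearIndependent ℝ v) (u : ι → ℤˣ) : LinearIndependent ℝ fun j => u j • v j := by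
  convert hv.units_smul fun j => Units.map (Int.castRingHom ℝ : ℤ →* ℝ) (u j) using 2 with j
  rcases Int.units_eq_one_or (u j) with h | h <;> simp [h, Units.smul_def]

/-- The polar of a bounded set has a dilate containing `i ≤ n` linearly independent lattice
points. -/
theorem exists_linearIndependent_mem_smul_polarBody {n : ℕ} {L : Set (E n)}
    (hL : Bornology.IsBounded L) {i : ℕ} (hi : i ≤ n) :
    ∃ lam : ℝ, 0 < lam ∧ ∃ v : Fin i → E n,
      LinearIndependent ℝ v ∧ ∀ j, isLatticePoint (v j) ∧ v j ∈ lam • polarBody L := by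
  obtain ⟨R, hR, hLR⟩ := hL.exists_pos_norm_le
  refine ⟨R, hR, fun j => EuclideanSpace.basisFun (Fin n) ℝ (Fin.castLE hi j), ?_,
    fun j => ⟨fun k => ?_, ?_⟩⟩
  · exact (EuclideanSpace.basisFun (Fin n) ℝ).orthonormal.linearIndependent.comp _
      (Fin.castLE_injective hi)
  · refine ⟨if k = Fin.castLE hi j then 1 else 0, ?_⟩
    simp
  · rw [mem_smul_polarBody hR]
    intro x hx
    refine (real_inner_le_norm _ _).trans ?_
    simpa using hLR x hx

theorem IsConvexBody.isBounded_csBody {n : ℕ} {K : Set (E n)} (hK : IsConvexBody K) :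
    Bornology.IsBounded (csBody K) :=
  (hK.2.1.isBounded.sub hK.2.1.isBounded).smul₀ _

theorem succMin_polar_le_succMin_cs_polar (n : ℕ) (K : Set (E n))
    (hK : IsConvexBody K) (h0 : (0 : E n) ∈ interior K)
    (i : ℕ) (hi1 : 1 ≤ i) (hin : i ≤ n) :
    succMin (polarBody K) i ≤ succMin (polarBody (csBody K)) i := by
  refine csInf_le_csInf ⟨0, fun _ h => h.1.le⟩
    (exists_linearIndependent_mem_smul_polarBody hK.isBounded_csBody hin) ?_
  rintro lam ⟨hlam, v, hv, hmem⟩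
  choose u hu using fun j => exists_units_smul_mem_smul_polarBody hlam (hmem j).2
  exact ⟨hlam, fun j => u j • v j, linearIndependent_int_units_smul hv u,
    fun j => ⟨(hmem j).1.units_smul (u j), hu j⟩⟩
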